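/- Let Ω ⊆ ℝ² be a nonempty open, simply connected set and let N : Ω → ℝ^{2×2} be a matrix field whose entries are twice continuously differentiable, with N₁₂(x) = N₂₁(x) (symmetry) and divDiv N(x) = 0 for all x ∈ Ω. Then there exists a continuously differentiable vector field ψ : Ω → ℝ² such that N(x) = symCurl ψ(x) for all x ∈ Ω. -/

import Mathlib

noncomputable section

open MeasureTheory Matrix

/-- The plane `ℝ²` as a Euclidean space. -/
abbrev E2 := EuclideanSpace ℝ (Fin 2)

/-- Partial derivative `∂ᵢ f` of a scalar field. -/
def pd (i : Fin 2) (f : E2 → ℝ) (x : E2) : ℝ :=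
  fderiv ℝ f x (EuclideanSpace.single i 1)

/-- `Curl ψ`: the 2×2 matrix field with rows `(∂₂ψᵢ, −∂₁ψᵢ)`. -/
def CurlM (ψ : E2 → Fin 2 → ℝ) (x : E2) : Matrix (Fin 2) (Fin 2) ℝ :=
  Matrix.of fun i => ![pd 1 (fun y => ψ y i) x, -pd 0 (fun y => ψ y i) x]

/-- `symCurl ψ = ½(Curl ψ + (Curl ψ)ᵀ)`. -/
def symCurlM (ψ : E2 → Fin 2 → ℝ) (x : E2) : Matrix (Fin 2) (Fin 2) ℝ :=
  (2⁻¹ : ℝ) • (CurlM ψ x + (CurlM ψ x)ᵀ)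

/-- Row-wise divergence of a matrix field: `(Div N)ᵢ = ∂₁N_{i1} + ∂₂N_{i2}`. -/
def DivM (N : E2 → Matrix (Fin 2) (Fin 2) ℝ) (x : E2) : Fin 2 → ℝ :=
  fun i => pd 0 (fun y => N y i 0) x + pd 1 (fun y => N y i 1) x

/-- Divergence of a vector field: `div w = ∂₁w₁ + ∂₂w₂`. -/
def divV (w : E2 → Fin 2 → ℝ) (x : E2) : ℝ :=
  pd 0 (fun y => w y 0) x + pd 1 (fun y => w y 1) x

/-- `divDiv N = div (Div N)`. -/
def divDivM (N : E2 → Matrix (Fin 2) (Fin 2) ℝ) (x : E2) : ℝ :=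
  divV (fun y => DivM N y) x

/-- Hessian matrix `(∇²v)_{ij} = ∂ᵢ∂ⱼ v`. -/
def hessM (v : E2 → ℝ) (x : E2) : Matrix (Fin 2) (Fin 2) ℝ :=
  Matrix.of fun i j => pd i (fun y => pd j v y) x

/-- The Frobenius inner product `A : B = Σ_{ij} A_{ij} B_{ij}`. -/
def frob (A B : Matrix (Fin 2) (Fin 2) ℝ) : ℝ :=
  ∑ i : Fin 2, ∑ j : Fin 2, A i j * B i j

open Set Filter Topology in
/-- On a simply connected, locally path connected space, local functions whose pairwise differences
are locally constant glue, up to locally constant corrections, to a global function. -/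
theorem exists_eventually_sub_eq_of_locallyConstant_sub {X A ι : Type*} [TopologicalSpace X]
    [SimplyConnectedSpace X] [LocallyPathConnectedSpace X] [AddCommGroup A]
    (U : ι → Set X) (hU : ∀ i, IsOpen (U i)) (hcover : ∀ x, ∃ i, x ∈ U i) (f : ι → X → A)
    (hf : ∀ i j, ∀ x ∈ U i ∩ U j, ∀ᶠ y in 𝓝 x, f i y - f j y = f i x - f j x) :
    ∃ g : X → A, ∀ i, ∀ x ∈ U i, ∀ᶠ y in 𝓝 x, g y - f i y = g x - f i x := by
  let _ : TopologicalSpace A := ⊥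
  have : DiscreteTopology A := ⟨rfl⟩
  choose k hk using hcover
  let Z : FiberBundleCore ι X A :=
    { baseSet := U
      isOpen_baseSet := hU
      indexAt := k
      mem_baseSet_at := hk
      coordChange := fun i j x v => v + (f i x - f j x)
      coordChange_self := by simp
      continuousOn_coordChange := by
        rintro i j ⟨x, v⟩ ⟨hx, -⟩
        apply ContinuousAt.continuousWithinAt
        have hev : (fun p : X × A => p.2 + (f i p.1 - f j p.1)) =ᶠ[𝓝 (x, v)]
            fun p => p.2 + (f i x - f j x) := by
          filter_upwards [continuousAt_fst.eventually (hf i j x hx)] with p hp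
          rw [hp]
        exact ((continuous_of_discreteTopology (f := fun a : A => a + (f i x - f j x))).comp
          continuous_snd).continuousAt.congr hev.symm
      coordChange_comp := by
        intro i j l x _ v
        abel }
  have hcov : IsCoveringMap Z.proj := FiberBundle.isCoveringMap (F := A) (E := Z.Fiber)
  obtain ⟨x₀⟩ : Nonempty X := inferInstance
  obtain ⟨s, ⟨-, hs⟩, -⟩ := hcov.existsUnique_continuousMap_lifts (ContinuousMap.id X) x₀
    (⟨x₀, (0 : A)⟩ : Z.TotalSpace) rfl
  have hs' : ∀ x, (s x).proj = x := fun x => congrFun hs x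
  let c : X → A := fun x => (s x).2
  refine ⟨fun x => c x + f (k x) x, fun i x hx => ?_⟩
  have hmem : s x ∈ (Z.localTriv i).source :=
    (Z.localTriv i).mem_source.2 (show (s x).proj ∈ U i by rwa [hs'])
  have hcont : ContinuousAt (fun y => ((Z.localTriv i) (s y)).2) x :=
    continuousAt_snd.comp
      (((Z.localTriv i).toOpenPartialHomeomorph.continuousAt hmem).comp s.continuous.continuousAt)
  have hval : ∀ y, ((Z.localTriv i) (s y)).2 = c y + (f (k y) y - f i y) := by
    intro y
    change c y + (f (k (s y).proj) (s y).proj - f i (s y).proj) = _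
    rw [hs']
  have hev := hcont.eventually_mem (mem_nhds_discrete.2 (mem_singleton _))
  filter_upwards [hev] with y hy
  rw [mem_singleton_iff, hval, hval] at hy
  simpa only [add_sub_assoc] using hy

open Set Filter Topology in
/-- **Poincaré lemma** on a simply connected open set: a closed `1`-form has a primitive. -/
theorem exists_forall_hasFDerivAt_of_simplyConnected {E F : Type*} [NormedAddCommGroup E]
    [NormedSpace ℝ E] [NormedAddCommGroup F] [NormedSpace ℝ F] [CompleteSpace F] {Ω : Set E}
    (hΩ : IsOpen Ω) (hsc : SimplyConnectedSpace Ω) {ω : E → E →L[ℝ] F}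
    (hω : DifferentiableOn ℝ ω Ω)
    (hdω : ∀ a ∈ Ω, ∀ x y, fderiv ℝ ω a x y = fderiv ℝ ω a y x) :
    ∃ f : E → F, ∀ a ∈ Ω, HasFDerivAt f (ω a) a := by
  classical
  have hloc : ∀ x : Ω, ∃ r > 0, Metric.ball (x : E) r ⊆ Ω := fun x =>
    Metric.isOpen_iff.1 hΩ x x.2
  choose r hr hball using hloc
  have hprim : ∀ x : Ω, ∃ f : E → F, ∀ a ∈ Metric.ball (x : E) (r x), HasFDerivAt f (ω a) a :=
    fun x => (convex_ball _ _).exists_forall_hasFDerivAt_of_fderiv_symmetric Metric.isOpen_ball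
      (hω.mono (hball x)) fun a ha => hdω a (hball x ha)
  choose f hf using hprim
  have := hΩ.locallyPathConnectedSpace
  obtain ⟨g, hg⟩ := exists_eventually_sub_eq_of_locallyConstant_sub
    (fun i : Ω => ((↑) : Ω → E) ⁻¹' Metric.ball (i : E) (r i))
    (fun i => Metric.isOpen_ball.preimage continuous_subtype_val)
    (fun x => ⟨x, Metric.mem_ball_self (hr x)⟩) (fun i x => f i x) (by
      intro i j x hx
      set B := Metric.ball (i : E) (r i) ∩ Metric.ball (j : E) (r j)
      have hBo : IsOpen B := Metric.isOpen_ball.inter Metric.isOpen_ball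
      have hBc : Convex ℝ B := (convex_ball _ _).inter (convex_ball _ _)
      have hd : ∀ y ∈ B, HasFDerivAt (fun z => f i z - f j z) (0 : E →L[ℝ] F) y := fun y hy => by
        simpa using (hf i y hy.1).fun_sub (hf j y hy.2)
      filter_upwards [(hBo.preimage continuous_subtype_val).mem_nhds hx] with y hy
      exact hBo.is_const_of_fderiv_eq_zero (𝕜 := ℝ) hBc.isPreconnected
        (fun z hz => (hd z hz).differentiableAt.differentiableWithinAt)
        (fun z hz => (hd z hz).fderiv) hy hx)
  refine ⟨fun x => if h : x ∈ Ω then g ⟨x, h⟩ else 0, fun a ha => ?_⟩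
  have hev := hg ⟨a, ha⟩ ⟨a, ha⟩ (Metric.mem_ball_self (hr _))
  rw [nhds_subtype_eq_comap] at hev
  have hd := (hf ⟨a, ha⟩ a (Metric.mem_ball_self (hr _))).add_const (g ⟨a, ha⟩ - f ⟨a, ha⟩ a)
  refine hd.congr_of_eventuallyEq ?_
  filter_upwards [eventually_comap.1 hev, hΩ.mem_nhds ha] with y hy hyΩ
  rw [dif_pos hyΩ, ← hy ⟨y, hyΩ⟩ rfl]
  abel

/-- The `1`-form `-u₂ dx₁ + u₁ dx₂` of which a stream function of `u` is a primitive. -/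
def streamForm (u : E2 → Fin 2 → ℝ) (x : E2) : E2 →L[ℝ] ℝ :=
  u x 0 • EuclideanSpace.proj 1 - u x 1 • EuclideanSpace.proj 0

/-- A differentiable divergence-free vector field on a simply connected open subset of the plane
has a stream function. -/
theorem exists_streamFunction {Ω : Set E2} (hΩ : IsOpen Ω) (hsc : SimplyConnectedSpace Ω)
    {u : E2 → Fin 2 → ℝ} (hu : ∀ i, DifferentiableOn ℝ (fun x => u x i) Ω)
    (hdiv : ∀ x ∈ Ω, divV u x = 0) :
    ∃ p : E2 → ℝ, ∀ x ∈ Ω, HasFDerivAt p (streamForm u x) x := by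
  have hd : ∀ a ∈ Ω, HasFDerivAt (streamForm u)
      ((fderiv ℝ (fun x => u x 0) a).smulRight (EuclideanSpace.proj 1 : E2 →L[ℝ] ℝ) -
        (fderiv ℝ (fun x => u x 1) a).smulRight (EuclideanSpace.proj 0 : E2 →L[ℝ] ℝ)) a :=
    fun a ha =>
      have h := fun i => ((hu i).differentiableAt (hΩ.mem_nhds ha)).hasFDerivAt
      ((h 0).smul_const (EuclideanSpace.proj 1 : E2 →L[ℝ] ℝ)).sub
        ((h 1).smul_const (EuclideanSpace.proj 0 : E2 →L[ℝ] ℝ))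
  refine exists_forall_hasFDerivAt_of_simplyConnected hΩ hsc
    (fun a ha => (hd a ha).differentiableAt.differentiableWithinAt) fun a ha x y => ?_
  have hexp : ∀ (L : E2 →L[ℝ] ℝ) (z : E2),
      L z = z 0 * L (EuclideanSpace.single 0 1) + z 1 * L (EuclideanSpace.single 1 1) := by
    intro L z
    have hz : z = z 0 • EuclideanSpace.single 0 1 + z 1 • EuclideanSpace.single 1 1 := by
      ext i
      fin_cases i <;> simp
    conv_lhs => rw [hz]
    simp
  have h0 := hdiv a ha
  simp only [divV, pd] at h0
  rw [(hd a ha).fderiv]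
  simp only [_root_.sub_apply, ContinuousLinearMap.smulRight_apply,
    _root_.smul_apply, PiLp.proj_apply, smul_eq_mul]
  rw [hexp (fderiv ℝ (fun x => u x 0) a) x, hexp (fderiv ℝ (fun x => u x 0) a) y,
    hexp (fderiv ℝ (fun x => u x 1) a) x, hexp (fderiv ℝ (fun x => u x 1) a) y]
  linear_combination (x 0 * y 1 - y 0 * x 1) * h0

theorem pd_streamFunction {u : E2 → Fin 2 → ℝ} {p : E2 → ℝ} {x : E2}
    (hp : HasFDerivAt p (streamForm u x) x) : pd 0 p x = -u x 1 ∧ pd 1 p x = u x 0 := by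
  simp [pd, hp.fderiv, streamForm]

theorem contDiffOn_pd {Ω : Set E2} (hΩ : IsOpen Ω) {f : E2 → ℝ} (hf : ContDiffOn ℝ 2 f Ω)
    (i : Fin 2) : ContDiffOn ℝ 1 (pd i f) Ω :=
  (hf.fderiv_of_isOpen hΩ (by norm_num)).clm_apply contDiffOn_const

theorem contDiffOn_streamFunction {Ω : Set E2} (hΩ : IsOpen Ω) {u : E2 → Fin 2 → ℝ}
    (hu : ∀ i, ContinuousOn (fun x => u x i) Ω) {p : E2 → ℝ}
    (hp : ∀ x ∈ Ω, HasFDerivAt p (streamForm u x) x) : ContDiffOn ℝ 1 p Ω := by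
  rw [show (1 : WithTop ℕ∞) = 0 + 1 from rfl, contDiffOn_succ_iff_fderiv_of_isOpen hΩ]
  refine ⟨fun x hx => (hp x hx).differentiableAt.differentiableWithinAt, by simp, ?_⟩
  rw [contDiffOn_zero]
  refine ContinuousOn.congr ?_ fun x hx => (hp x hx).fderiv
  exact ((hu 0).smul continuousOn_const).sub ((hu 1).smul continuousOn_const)

/-- On a nonempty open simply connected set `Ω ⊆ ℝ²`, every symmetric matrix
field `N` with `C²` entries satisfying `divDiv N = 0` on `Ω` is of the form
`N = symCurl ψ` for some `C¹` vector field `ψ`. -/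
theorem divDiv_free_symmetric_is_symCurl (Ω : Set E2) (hne : Ω.Nonempty)
    (hΩ : IsOpen Ω) (hsc : SimplyConnectedSpace Ω)
    (N : E2 → Matrix (Fin 2) (Fin 2) ℝ)
    (hN : ∀ i j, ContDiffOn ℝ 2 (fun x => N x i j) Ω)
    (hsym : ∀ x ∈ Ω, N x 0 1 = N x 1 0)
    (hdd : ∀ x ∈ Ω, divDivM N x = 0) :
    ∃ ψ : E2 → Fin 2 → ℝ, ContDiffOn ℝ 1 ψ Ω ∧ ∀ x ∈ Ω, N x = symCurlM ψ x := by
  have hDiv : ∀ i, DifferentiableOn ℝ (fun x => DivM N x i) Ω := fun i =>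
    ((contDiffOn_pd hΩ (hN i 0) 0).add (contDiffOn_pd hΩ (hN i 1) 1)).differentiableOn
      one_ne_zero
  obtain ⟨p, hp⟩ := exists_streamFunction hΩ hsc hDiv hdd
  have hpd : DifferentiableOn ℝ p Ω := fun x hx => (hp x hx).differentiableAt.differentiableWithinAt
  have hNd : ∀ i j, DifferentiableOn ℝ (fun x => N x i j) Ω := fun i j =>
    (hN i j).differentiableOn two_ne_zero
  let r : E2 → Fin 2 → ℝ := fun x => ![N x 0 0, N x 0 1 - p x]
  let s : E2 → Fin 2 → ℝ := fun x => ![N x 1 0 + p x, N x 1 1]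
  have hr : ∀ i, DifferentiableOn ℝ (fun x => r x i) Ω :=
    Fin.forall_fin_two.2 ⟨hNd 0 0, (hNd 0 1).sub hpd⟩
  have hs : ∀ i, DifferentiableOn ℝ (fun x => s x i) Ω :=
    Fin.forall_fin_two.2 ⟨(hNd 1 0).add hpd, hNd 1 1⟩
  have hrdiv : ∀ x ∈ Ω, divV r x = 0 := by
    intro x hx
    have h := (pd_streamFunction (hp x hx)).2
    simp only [DivM, pd] at h
    simp only [divV, pd, r, cons_val_zero, cons_val_one]
    rw [fderiv_fun_sub ((hNd 0 1).differentiableAt (hΩ.mem_nhds hx)) (hp x hx).differentiableAt,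
      _root_.sub_apply, h]
    ring
  have hsdiv : ∀ x ∈ Ω, divV s x = 0 := by
    intro x hx
    have h := (pd_streamFunction (hp x hx)).1
    simp only [DivM, pd] at h
    simp only [divV, pd, s, cons_val_zero, cons_val_one]
    rw [fderiv_fun_add ((hNd 1 0).differentiableAt (hΩ.mem_nhds hx)) (hp x hx).differentiableAt,
      _root_.add_apply, h]
    ring
  obtain ⟨ψ₁, hψ₁⟩ := exists_streamFunction hΩ hsc hr hrdiv
  obtain ⟨ψ₂, hψ₂⟩ := exists_streamFunction hΩ hsc hs hsdiv
  refine ⟨fun x => ![ψ₁ x, ψ₂ x], contDiffOn_pi.2 (Fin.forall_fin_two.2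
    ⟨contDiffOn_streamFunction hΩ (fun i => (hr i).continuousOn) hψ₁,
      contDiffOn_streamFunction hΩ (fun i => (hs i).continuousOn) hψ₂⟩), fun x hx => ?_⟩
  obtain ⟨h₁, h₁'⟩ := pd_streamFunction (hψ₁ x hx)
  obtain ⟨h₂, h₂'⟩ := pd_streamFunction (hψ₂ x hx)
  have h := hsym x hx
  ext i j
  fin_cases i <;> fin_cases j <;>
    simp [symCurlM, CurlM, h₁, h₁', h₂, h₂', r, s] <;> linarith
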